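/- Let $N_t, N_r \ge 1$ be integers with $q = \min(N_t,N_r)$, and $\delta_t \ge 0$, $\delta_r \ge 0$ reals. Let $\Lambda$ be a nonnegative real random variable with $q\,\mathbb{E}[\Lambda] = N_r N_t$, $q\,\mathbb{E}[\Lambda^2] = N_r N_t (N_r + N_t)$, and $\mathbb{E}[\Lambda^2] < \infty$, and define $C(\rho) = q\,\mathbb{E}\big[\log_2\big(1 + \frac{(\rho/N_t)\Lambda}{(\rho\delta_t^2/N_t)\Lambda + \rho\delta_r^2 + 1}\big)\big]$ for $\rho \ge 0$. Then $C$ is twice differentiable at $\rho = 0$ with $C''(0) = -\frac{N_r}{\ln 2}\big(\frac{(2\delta_t^2+1)(N_t+N_r)}{N_t} + 2\delta_r^2\big)$; consequently the wideband slope $S_0 = -2\ln(2)\,[C'(0)]^2 / C''(0)$ equals $\dfrac{2 N_t N_r}{(2\delta_t^2+1)(N_t+N_r) + 2\delta_r^2 N_t}$. -/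

import Mathlib

open MeasureTheory Set Filter

/-- One-sided differentiation under the integral sign on `[0, ∞)`. -/
theorem hasDerivWithinAt_integral_Ici_of_bound {Ω : Type*} [MeasurableSpace Ω] {μ : Measure Ω}
    {F F' : ℝ → Ω → ℝ} {bound : Ω → ℝ}
    (hF : ∀ ρ, 0 ≤ ρ → Integrable (F ρ) μ)
    (hderiv : ∀ ω, ∀ ρ, 0 ≤ ρ → HasDerivWithinAt (fun x => F x ω) (F' ρ ω) (Ici 0) ρ)
    (hbound : ∀ ω, ∀ ρ, 0 ≤ ρ → |F' ρ ω| ≤ bound ω)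
    (hint : Integrable bound μ) {x : ℝ} (hx : 0 ≤ x) :
    HasDerivWithinAt (fun ρ => ∫ ω, F ρ ω ∂μ) (∫ ω, F' x ω ∂μ) (Ici 0) x := by
  rw [hasDerivWithinAt_iff_tendsto_slope]
  have hmem : ∀ᶠ y in nhdsWithin x (Ici 0 \ {x}), y ∈ Ici (0 : ℝ) \ {x} := self_mem_nhdsWithin
  have key : Tendsto (fun y => ∫ ω, slope (fun z => F z ω) x y ∂μ)
      (nhdsWithin x (Ici 0 \ {x})) (nhds (∫ ω, F' x ω ∂μ)) := by
    refine tendsto_integral_filter_of_dominated_convergence bound ?_ ?_ hint ?_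
    · filter_upwards [hmem] with y hy
      simp only [slope_def_module]
      exact (((hF y hy.1).sub (hF x hx)).smul (y - x)⁻¹).aestronglyMeasurable
    · filter_upwards [hmem] with y hy
      refine Eventually.of_forall fun ω => ?_
      have h := (convex_Ici (0 : ℝ)).norm_image_sub_le_of_norm_hasDerivWithin_le
        (fun z hz => hderiv ω z hz) (fun z hz => hbound ω z hz) hx hy.1
      have hne : 0 < |y - x| := abs_pos.2 (sub_ne_zero.2 hy.2)
      rw [slope_def_field, norm_div, Real.norm_eq_abs (y - x), div_le_iff₀ hne]
      exact h
    · refine Eventually.of_forall fun ω => ?_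
      exact (hasDerivWithinAt_iff_tendsto_slope.1 (hderiv ω x hx))
  refine key.congr' ?_
  filter_upwards [hmem] with y hy
  simp only [slope_def_module]
  rw [integral_smul, integral_sub (hF y hy.1) (hF x hx)]

section LogOneAddMul

variable {Ω : Type*} [MeasurableSpace Ω] {μ : Measure Ω} {c : Ω → ℝ}

theorem integrable_log_one_add_mul (hm : Measurable c) (hc : ∀ ω, 0 ≤ c ω)
    (h1 : Integrable c μ) {ρ : ℝ} (hρ : 0 ≤ ρ) :
    Integrable (fun ω => Real.log (1 + ρ * c ω)) μ := by
  refine (h1.const_mul ρ).mono' (Measurable.aestronglyMeasurable (by fun_prop))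
      (Eventually.of_forall fun ω => ?_)
  have h0 : 0 ≤ ρ * c ω := mul_nonneg hρ (hc ω)
  rw [Real.norm_eq_abs, abs_of_nonneg (Real.log_nonneg (by linarith))]
  linarith [Real.log_le_sub_one_of_pos (show 0 < 1 + ρ * c ω by linarith)]

theorem hasDerivWithinAt_integral_log_one_add_mul (hm : Measurable c) (hc : ∀ ω, 0 ≤ c ω)
    (h1 : Integrable c μ) {x : ℝ} (hx : 0 ≤ x) :
    HasDerivWithinAt (fun ρ => ∫ ω, Real.log (1 + ρ * c ω) ∂μ)
      (∫ ω, c ω / (1 + x * c ω) ∂μ) (Ici 0) x := by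
  refine hasDerivWithinAt_integral_Ici_of_bound (F := fun ρ ω => Real.log (1 + ρ * c ω))
    (F' := fun ρ ω => c ω / (1 + ρ * c ω)) (bound := c)
    (fun ρ hρ => integrable_log_one_add_mul hm hc h1 hρ) ?_ ?_ h1 hx
  · intro ω ρ hρ
    have h0 : 0 ≤ ρ * c ω := mul_nonneg hρ (hc ω)
    have h := ((hasDerivAt_id ρ).mul_const (c ω)).const_add 1
    simpa using (h.log (by simp only [id]; positivity)).hasDerivWithinAt
  · intro ω ρ hρ
    have h0 : 0 ≤ ρ * c ω := mul_nonneg hρ (hc ω)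
    rw [abs_of_nonneg (div_nonneg (hc ω) (by positivity))]
    exact div_le_self (hc ω) (by linarith)

theorem hasDerivWithinAt_integral_div_one_add_mul (hm : Measurable c) (hc : ∀ ω, 0 ≤ c ω)
    (h1 : Integrable c μ) (h2 : Integrable (fun ω => c ω ^ 2) μ) :
    HasDerivWithinAt (fun ρ => ∫ ω, c ω / (1 + ρ * c ω) ∂μ)
      (-∫ ω, c ω ^ 2 ∂μ) (Ici 0) 0 := by
  have h := hasDerivWithinAt_integral_Ici_of_bound (μ := μ)
    (F := fun ρ ω => c ω / (1 + ρ * c ω))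
    (F' := fun ρ ω => -(c ω ^ 2 / (1 + ρ * c ω) ^ 2)) (bound := fun ω => c ω ^ 2)
    ?_ ?_ ?_ h2 le_rfl
  · simpa [integral_neg] using h
  · intro ρ hρ
    refine h1.mono' (Measurable.aestronglyMeasurable (by fun_prop))
      (Eventually.of_forall fun ω => ?_)
    have h0 : 0 ≤ ρ * c ω := mul_nonneg hρ (hc ω)
    rw [Real.norm_eq_abs, abs_of_nonneg (div_nonneg (hc ω) (by positivity))]
    exact div_le_self (hc ω) (by linarith)
  · intro ω ρ hρ
    have h0 : 0 ≤ ρ * c ω := mul_nonneg hρ (hc ω)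
    have hne : 1 + ρ * c ω ≠ 0 := by positivity
    have hd := ((hasDerivAt_id ρ).mul_const (c ω)).const_add 1
    have := ((hasDerivAt_const ρ (c ω)).div hd hne).hasDerivWithinAt (s := Ici 0)
    refine this.congr_deriv ?_
    simp only [id]
    ring
  · intro ω ρ hρ
    have h0 : 0 ≤ ρ * c ω := mul_nonneg hρ (hc ω)
    rw [abs_neg, abs_of_nonneg (by positivity)]
    exact div_le_self (sq_nonneg _) (one_le_pow₀ (by linarith))

end LogOneAddMul

/-- Wideband-slope analysis: with `C(ρ) = q E[log₂(1 + SINR(ρ,Λ))]`,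
`q E[Λ] = N_r N_t`, `q E[Λ²] = N_r N_t (N_r + N_t)` and `E[Λ²] < ∞`, the
capacity is twice differentiable at `ρ = 0` (from the right) with
`C'(0) = N_r / ln 2` and
`C''(0) = -(N_r/ln 2)((2δt²+1)(N_t+N_r)/N_t + 2δr²)`; consequently the wideband
slope `S₀ = -2 ln 2 [C'(0)]² / C''(0)` equals
`2 N_t N_r / ((2δt²+1)(N_t+N_r) + 2δr² N_t)`. -/
theorem wideband_slope
    {Ω : Type*} [MeasureSpace Ω] [IsProbabilityMeasure (volume : Measure Ω)]
    (Nt Nr : ℕ) (hNt : 1 ≤ Nt) (hNr : 1 ≤ Nr)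
    (q : ℕ) (hq : q = min Nt Nr)
    (δt δr : ℝ) (hδt : 0 ≤ δt) (hδr : 0 ≤ δr)
    (Λ : Ω → ℝ) (hΛmeas : Measurable Λ) (hΛnonneg : ∀ ω, 0 ≤ Λ ω)
    (hΛsq : Integrable (fun ω => Λ ω ^ 2))
    (hmom1 : (q : ℝ) * ∫ ω, Λ ω = Nr * Nt)
    (hmom2 : (q : ℝ) * ∫ ω, Λ ω ^ 2 = Nr * Nt * (Nr + Nt))
    (C : ℝ → ℝ)
    (hC : ∀ ρ : ℝ, C ρ = q * ∫ ω, Real.logb 2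
        (1 + (ρ / Nt * Λ ω) / ((ρ * δt ^ 2 / Nt) * Λ ω + ρ * δr ^ 2 + 1))) :
    HasDerivWithinAt C ((Nr : ℝ) / Real.log 2) (Ici 0) 0 ∧
    HasDerivWithinAt (derivWithin C (Ici 0))
      (-((Nr : ℝ) / Real.log 2)
        * ((2 * δt ^ 2 + 1) * ((Nt : ℝ) + Nr) / Nt + 2 * δr ^ 2)) (Ici 0) 0 ∧
    -2 * Real.log 2 * ((Nr : ℝ) / Real.log 2) ^ 2
        / (-((Nr : ℝ) / Real.log 2)
            * ((2 * δt ^ 2 + 1) * ((Nt : ℝ) + Nr) / Nt + 2 * δr ^ 2))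
      = 2 * Nt * Nr / ((2 * δt ^ 2 + 1) * ((Nt : ℝ) + Nr) + 2 * δr ^ 2 * Nt) := by
  have hNt0 : (0 : ℝ) < Nt := by exact_mod_cast hNt
  have hNr0 : (0 : ℝ) < Nr := by exact_mod_cast hNr
  have hl2 : 0 < Real.log 2 := Real.log_pos one_lt_two
  have hΛ1 : Integrable Λ :=
    ((memLp_two_iff_integrable_sq hΛmeas.aestronglyMeasurable).2 hΛsq).integrable one_le_two
  -- The two rates: with distortion noise plus signal, and with distortion noise only.
  set b : Ω → ℝ := fun ω => δt ^ 2 / Nt * Λ ω + δr ^ 2 with hb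
  set s : Ω → ℝ := fun ω => (1 + δt ^ 2) / Nt * Λ ω + δr ^ 2 with hs
  have affine_sq : ∀ k : ℝ, (fun ω => (k * Λ ω + δr ^ 2) ^ 2) =
      fun ω => k ^ 2 * Λ ω ^ 2 + (2 * k * δr ^ 2 * Λ ω + δr ^ 4) := fun k => by
    funext ω; ring
  have int_affine : ∀ k : ℝ, Integrable fun ω => k * Λ ω + δr ^ 2 := fun k =>
    (hΛ1.const_mul k).add (integrable_const _)
  have int_affine_sq : ∀ k : ℝ, Integrable fun ω => (k * Λ ω + δr ^ 2) ^ 2 := fun k => by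
    rw [affine_sq]
    exact (hΛsq.const_mul _).add ((hΛ1.const_mul _).add (integrable_const _))
  have val_affine : ∀ k : ℝ, ∫ ω, (k * Λ ω + δr ^ 2) = k * (∫ ω, Λ ω) + δr ^ 2 := fun k => by
    rw [integral_add (hΛ1.const_mul k) (integrable_const _), integral_const_mul]
    simp
  have val_affine_sq : ∀ k : ℝ, ∫ ω, (k * Λ ω + δr ^ 2) ^ 2 =
      k ^ 2 * (∫ ω, Λ ω ^ 2) + (2 * k * δr ^ 2 * (∫ ω, Λ ω) + δr ^ 4) := fun k => by
    have h1 : Integrable fun ω => 2 * k * δr ^ 2 * Λ ω + δr ^ 4 :=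
      (hΛ1.const_mul _).add (integrable_const _)
    rw [affine_sq, integral_add (hΛsq.const_mul _) h1,
      integral_add (hΛ1.const_mul _) (integrable_const _), integral_const_mul, integral_const_mul]
    simp
  have hbm : Measurable b := by fun_prop
  have hsm : Measurable s := by fun_prop
  have hb0 : ∀ ω, 0 ≤ b ω := fun ω => by have := hΛnonneg ω; positivity
  have hs0 : ∀ ω, 0 ≤ s ω := fun ω => by have := hΛnonneg ω; positivity
  have hb1 : Integrable b := int_affine _
  have hs1 : Integrable s := int_affine _
  have hC' : ∀ ρ ∈ Ici (0 : ℝ), C ρ = q / Real.log 2 *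
      ((∫ ω, Real.log (1 + ρ * s ω)) - ∫ ω, Real.log (1 + ρ * b ω)) := by
    intro ρ hρ
    rw [hC ρ, ← integral_sub (integrable_log_one_add_mul hsm hs0 hs1 hρ)
      (integrable_log_one_add_mul hbm hb0 hb1 hρ), div_mul_eq_mul_div, mul_div_assoc (q : ℝ),
      ← integral_div]
    congr 2
    funext ω
    have h1 : 0 < 1 + ρ * b ω := by have := mul_nonneg hρ (hb0 ω); linarith
    have h2 : 0 < 1 + ρ * s ω := by have := mul_nonneg hρ (hs0 ω); linarith
    have hden : ρ * δt ^ 2 / Nt * Λ ω + ρ * δr ^ 2 + 1 = 1 + ρ * b ω := by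
      simp only [hb]; ring
    have hnum : 1 + ρ * b ω + ρ / Nt * Λ ω = 1 + ρ * s ω := by
      simp only [hb, hs]; ring
    rw [← Real.log_div h2.ne' h1.ne', Real.logb, hden, one_add_div h1.ne', hnum]
  have hD : ∀ x ∈ Ici (0 : ℝ), HasDerivWithinAt C (q / Real.log 2 *
      ((∫ ω, s ω / (1 + x * s ω)) - ∫ ω, b ω / (1 + x * b ω))) (Ici 0) x := fun x hx =>
    (((hasDerivWithinAt_integral_log_one_add_mul hsm hs0 hs1 hx).sub
      (hasDerivWithinAt_integral_log_one_add_mul hbm hb0 hb1 hx)).const_mul _).congr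
      hC' (hC' x hx)
  have hD' : ∀ x ∈ Ici (0 : ℝ), derivWithin C (Ici 0) x = q / Real.log 2 *
      ((∫ ω, s ω / (1 + x * s ω)) - ∫ ω, b ω / (1 + x * b ω)) := fun x hx =>
    (hD x hx).derivWithin (uniqueDiffOn_Ici 0 x hx)
  refine ⟨(hD 0 self_mem_Ici).congr_deriv ?_, ?_, ?_⟩
  · simp only [zero_mul, add_zero, div_one]
    rw [hb, hs, val_affine, val_affine]
    calc _ = ((q : ℝ) * ∫ ω, Λ ω) / (Nt * Real.log 2) := by field_simp; ring
      _ = _ := by rw [hmom1]; field_simp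
  · refine ((((hasDerivWithinAt_integral_div_one_add_mul hsm hs0 hs1 (int_affine_sq _)).sub
      (hasDerivWithinAt_integral_div_one_add_mul hbm hb0 hb1 (int_affine_sq _))).const_mul
      (q / Real.log 2)).congr hD' (hD' 0 self_mem_Ici)).congr_deriv ?_
    rw [hb, hs, val_affine_sq, val_affine_sq]
    calc _ = -((1 + 2 * δt ^ 2) / Nt ^ 2 * ((q : ℝ) * ∫ ω, Λ ω ^ 2)
          + 2 * δr ^ 2 / Nt * ((q : ℝ) * ∫ ω, Λ ω)) / Real.log 2 := by field_simp; ring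
      _ = _ := by rw [hmom1, hmom2]; field_simp; ring
  · have : 0 < (2 * δt ^ 2 + 1) * ((Nt : ℝ) + Nr) + 2 * δr ^ 2 * Nt := by positivity
    have h2 : (2 * δt ^ 2 + 1) * ((Nt : ℝ) + Nr) / Nt + 2 * δr ^ 2 =
        ((2 * δt ^ 2 + 1) * ((Nt : ℝ) + Nr) + 2 * δr ^ 2 * Nt) / Nt := by field_simp
    rw [h2]
    generalize (2 * δt ^ 2 + 1) * ((Nt : ℝ) + Nr) + 2 * δr ^ 2 * Nt = D at this ⊢
    field_simp
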